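/- Let X be an absolute Borel space (a topological space homeomorphic to a Borel subspace of a completely metrizable space). If X is 2^ω-coverable, then there is a packing of Cantor spaces into X of cardinality |X|. -/

import Mathlib

open Cardinal Set TopologicalSpace

/-- The Cantor space `2^ω`. -/
abbrev CantorSpace : Type := ℕ → Bool

/-- `X` is `Y`-coverable: there is a family of subspaces of `X`, each homeomorphic to `Y`,
whose union is `X`. -/
def Coverable (X Y : Type*) [TopologicalSpace X] [TopologicalSpace Y] : Prop :=
  ∃ C : Set (Set X), (∀ K ∈ C, Nonempty (K ≃ₜ Y)) ∧ ⋃₀ C = Set.univ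

/-- `X` is `Y`-partitionable: there is a partition of `X` into pairwise disjoint subspaces,
each homeomorphic to `Y`. -/
def Partitionable (X Y : Type*) [TopologicalSpace X] [TopologicalSpace Y] : Prop :=
  ∃ P : Set (Set X), (∀ K ∈ P, Nonempty (K ≃ₜ Y)) ∧ P.PairwiseDisjoint id ∧ ⋃₀ P = Set.univ

/-- A packing of copies of `Y` into `X`: a pairwise disjoint family of subspaces of `X`,
each homeomorphic to `Y`. -/
def IsPacking {X : Type*} [TopologicalSpace X] (Y : Type*) [TopologicalSpace Y]
    (Q : Set (Set X)) : Prop :=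
  (∀ K ∈ Q, Nonempty (K ≃ₜ Y)) ∧ Q.PairwiseDisjoint id
/-- An absolute Borel space: a topological space homeomorphic to a Borel subset (with the
subspace topology) of some completely metrizable space. -/
def IsAbsoluteBorel (X : Type u) [TopologicalSpace X] : Prop :=
  ∃ (Z : Type u) (m : MetricSpace Z), letI := m;
    CompleteSpace Z ∧ ∃ B : Set Z, @MeasurableSet Z (borel Z) B ∧ Nonempty (X ≃ₜ B)


open Filter Topology Metric

/-- A single branching step: separated images allow one to choose small open sets, one for each
index, whose closures stay inside a given open set and whose images are pairwise disjoint. -/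
lemma exists_separated_open_family {Y X E : Type*} [PseudoMetricSpace Y] [PseudoMetricSpace X]
    {g : Y → X} (hg : Continuous g) {U : Set Y} (hU : IsOpen U) {ε δ : ℝ} (hε : 0 < ε)
    (hδ : 0 < δ) {φ : E → Y} (hφ : ∀ e, φ e ∈ U)
    (hsep : ∀ e e', e ≠ e' → ε ≤ dist (g (φ e)) (g (φ e'))) :
    ∃ V : E → Set Y, (∀ e, IsOpen (V e) ∧ (V e).Nonempty ∧ closure (V e) ⊆ U ∧
      ∀ a ∈ V e, ∀ b ∈ V e, dist a b ≤ 2 * δ) ∧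
      ∀ e e', e ≠ e' → Disjoint (g '' V e) (g '' V e') := by
  have key : ∀ e, ∃ r > 0, r ≤ δ ∧ closedBall (φ e) r ⊆ U ∧
      ∀ y ∈ ball (φ e) r, dist (g y) (g (φ e)) < ε / 2 := by
    intro e
    obtain ⟨r₁, h₁, h₁'⟩ := nhds_basis_closedBall.mem_iff.1 (hU.mem_nhds (hφ e))
    obtain ⟨r₂, h₂, h₂'⟩ := Metric.continuous_iff.1 hg (φ e) (ε / 2) (half_pos hε)
    refine ⟨min δ (min r₁ r₂), by positivity, min_le_left _ _, ?_, fun y hy => h₂' y ?_⟩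
    · exact (closedBall_subset_closedBall (by simp)).trans h₁'
    · exact (mem_ball.1 hy).trans_le (by simp)
  choose r hr hrδ hrU hrg using key
  refine ⟨fun e => ball (φ e) (r e), fun e => ⟨isOpen_ball, ⟨_, mem_ball_self (hr e)⟩,
    closure_ball_subset_closedBall.trans (hrU e), fun a ha b hb => ?_⟩, fun e e' hne => ?_⟩
  · have := dist_triangle_right a b (φ e)
    rw [mem_ball] at ha hb
    linarith [hrδ e]
  · rw [Set.disjoint_left]
    rintro _ ⟨a, ha, rfl⟩ ⟨b, hb, hab⟩
    have h₁ := hrg e a ha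
    have h₂ := hrg e' b hb
    have h₃ := dist_triangle_left (g (φ e)) (g (φ e')) (g a)
    rw [hab] at h₂
    linarith [hsep e e' hne]

/-- If every nonempty open subset of a complete metric space `Y` contains, for every `n`, a family
indexed by `E n` with uniformly separated images under `g : Y → X`, then the product of the
discrete spaces `E n` embeds continuously and injectively into `X`. -/
lemma exists_continuous_injective_pi {Y X : Type*} [MetricSpace Y] [CompleteSpace Y] [Nonempty Y]
    [PseudoMetricSpace X] {g : Y → X} (hg : Continuous g) {E : ℕ → Type*}
    [∀ n, TopologicalSpace (E n)] [∀ n, DiscreteTopology (E n)]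
    (H : ∀ U : Set Y, IsOpen U → U.Nonempty → ∀ n, ∃ ε > 0, ∃ φ : E n → Y, (∀ e, φ e ∈ U) ∧
      ∀ e e', e ≠ e' → ε ≤ dist (g (φ e)) (g (φ e'))) :
    ∃ h : (∀ n, E n) → X, Continuous h ∧ Function.Injective h := by
  let O := {U : Set Y // IsOpen U ∧ U.Nonempty}
  have step : ∀ (U : O) (n : ℕ), ∃ V : E n → O,
      (∀ e, closure (V e).1 ⊆ U.1 ∧ ∀ a ∈ (V e).1, ∀ b ∈ (V e).1,
        dist a b ≤ 2 * (1 / ((n : ℝ) + 1))) ∧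
      ∀ e e', e ≠ e' → Disjoint (g '' (V e).1) (g '' (V e').1) := by
    intro U n
    obtain ⟨ε, hε, φ, hφ, hsep⟩ := H U.1 U.2.1 U.2.2 n
    obtain ⟨V, hV, hV'⟩ := exists_separated_open_family hg U.2.1 hε
      (Nat.one_div_pos_of_nat (α := ℝ) (n := n)) hφ hsep
    exact ⟨fun e => ⟨V e, (hV e).1, (hV e).2.1⟩, fun e => (hV e).2.2, hV'⟩
  choose V hV hVdisj using step
  let A : (∀ n, E n) → ℕ → O := fun x n =>
    Nat.rec ⟨univ, isOpen_univ, univ_nonempty⟩ (fun k U => V U k (x k)) n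
  have A_succ : ∀ x n, A x (n + 1) = V (A x n) n (x n) := fun _ _ => rfl
  have A_congr : ∀ x y n, (∀ i < n, x i = y i) → A x n = A y n := by
    intro x y n
    induction n with
    | zero => exact fun _ => rfl
    | succ k ih =>
      intro h
      rw [A_succ, A_succ, ih fun i hi => h i (by omega), h k (by omega)]
  have A_closure : ∀ x n, closure (A x (n + 1)).1 ⊆ (A x n).1 := fun x n => (hV _ _ _).1
  have A_anti : ∀ x, Antitone fun n => (A x n).1 := fun x =>
    antitone_nat_of_succ_le fun n => subset_closure.trans (A_closure x n)
  have A_dist : ∀ x n, ∀ a ∈ (A x (n + 1)).1, ∀ b ∈ (A x (n + 1)).1,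
      dist a b ≤ 2 * (1 / ((n : ℝ) + 1)) := fun x n => (hV _ _ _).2
  have lim0 : Tendsto (fun n : ℕ => 2 * (1 / ((n : ℝ) + 1))) atTop (𝓝 0) := by
    simpa using (tendsto_one_div_add_atTop_nhds_zero_nat (𝕜 := ℝ)).const_mul 2
  have point : ∀ x, ∃ p, ∀ n, p ∈ (A x n).1 := by
    intro x
    choose y hy using fun n => (A x (n + 1)).2.2
    have hc : CauchySeq y := by
      refine cauchySeq_of_le_tendsto_0 _ (fun n m N hn hm => ?_) lim0
      exact A_dist x N _ (A_anti x (Nat.succ_le_succ hn) (hy n)) _ (A_anti x (Nat.succ_le_succ hm) (hy m))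
    obtain ⟨p, hp⟩ := cauchySeq_tendsto_of_complete hc
    refine ⟨p, fun n => A_closure x n (mem_closure_of_tendsto hp ?_)⟩
    filter_upwards [Ici_mem_atTop n] with m hm
    exact A_anti x (Nat.succ_le_succ (mem_Ici.1 hm)) (hy m)
  choose p hp using point
  refine ⟨g ∘ p, hg.comp ?_, ?_⟩
  · rw [continuous_iff_continuousAt]
    intro x
    rw [ContinuousAt, Metric.tendsto_nhds]
    intro ε hε
    obtain ⟨n, hn⟩ := (lim0.eventually_lt_const hε).exists
    filter_upwards [(PiNat.isOpen_cylinder E x (n + 1)).mem_nhds (PiNat.self_mem_cylinder x _)]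
      with y hy
    refine (A_dist x n _ ?_ _ (hp x (n + 1))).trans_lt hn
    rw [← A_congr y x (n + 1) (PiNat.mem_cylinder_iff.1 hy)]
    exact hp y (n + 1)
  · intro x y hxy
    by_contra hne
    have hd := PiNat.apply_firstDiff_ne hne
    set n := PiNat.firstDiff x y
    have hA : A x n = A y n := A_congr x y n fun i hi => PiNat.apply_eq_of_lt_firstDiff hi
    refine Set.disjoint_left.1 (hVdisj (A x n) n _ _ hd) ⟨p x, ?_, rfl⟩ ⟨p y, ?_, hxy.symm⟩
    · exact hp x (n + 1)
    · rw [hA]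
      exact hp y (n + 1)

/-- In a Fréchet-Urysohn Hausdorff space, a set `S` has closure of size at most `#S ^ ℵ₀`. -/
lemma mk_closure_le {X : Type u} [TopologicalSpace X] [T2Space X] [FrechetUrysohnSpace X]
    (S : Set X) : #(closure S) ≤ #S ^ ℵ₀ := by
  have : ∀ x : closure S, ∃ f : ℕ → S, Tendsto (fun n => (f n : X)) atTop (𝓝 x) := by
    rintro ⟨x, hx⟩
    obtain ⟨f, hf, hx⟩ := mem_closure_iff_seq_limit.1 hx
    exact ⟨fun n => ⟨f n, hf n⟩, hx⟩
  choose f hf using this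
  have hinj : Function.Injective f := fun x y hxy =>
    Subtype.ext (tendsto_nhds_unique (hf x) (hxy ▸ hf y))
  simpa using mk_le_of_injective hinj

/-- A set of size more than `(max #E ℵ₀) ^ ℵ₀` contains, for some `ε > 0`, an `ε`-separated family
indexed by `E`. -/
lemma exists_separated_family {X : Type u} [MetricSpace X] (S : Set X) (E : Type u)
    (hS : (max #E ℵ₀) ^ ℵ₀ < #S) :
    ∃ ε > 0, ∃ φ : E → X, (∀ e, φ e ∈ S) ∧ ∀ e e', e ≠ e' → ε ≤ dist (φ e) (φ e') := by
  by_contra hcon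
  push Not at hcon
  have hmax : ∀ n : ℕ, ∃ N, Maximal
      (fun N : Set X => N ⊆ S ∧ N.Pairwise fun a b => 1 / ((n : ℝ) + 1) ≤ dist a b) N := by
    intro n
    refine zorn_subset {N : Set X | N ⊆ S ∧ N.Pairwise fun a b => 1 / ((n : ℝ) + 1) ≤ dist a b}
      fun c hc hchain => ⟨⋃₀ c, ⟨sUnion_subset fun N hN => (hc hN).1, ?_⟩,
      fun N hN => subset_sUnion_of_mem hN⟩
    exact (pairwise_sUnion hchain.directedOn).2 fun N hN => (hc hN).2
  choose N hN using hmax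
  have hcard : ∀ n, #(N n) ≤ #E := by
    intro n
    by_contra h
    obtain ⟨f⟩ := (not_le.1 h).le
    obtain ⟨e, e', hne, hlt⟩ := hcon _ Nat.one_div_pos_of_nat (fun e => (f e : X))
      fun e => (hN n).1.1 (f e).2
    exact hlt.not_ge ((hN n).1.2 (f e).2 (f e').2 fun h => hne (f.injective (Subtype.ext h)))
  have hdense : S ⊆ closure (⋃ n, N n) := by
    intro x hx
    rw [Metric.mem_closure_iff]
    intro ε hε
    obtain ⟨n, hn⟩ := exists_nat_one_div_lt hε
    by_contra hfar
    push Not at hfar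
    have hxN : ∀ b ∈ N n, 1 / ((n : ℝ) + 1) ≤ dist x b := fun b hb =>
      hn.le.trans (hfar b (mem_iUnion_of_mem n hb))
    have hmem : x ∈ N n := by
      refine (hN n).2 (y := insert x (N n)) ⟨insert_subset hx (hN n).1.1, ?_⟩
        (subset_insert _ _) (mem_insert _ _)
      refine (hN n).1.2.insert fun b hb _ => ⟨hxN b hb, ?_⟩
      rw [dist_comm]
      exact hxN b hb
    exact (hε.trans_le (hfar x (mem_iUnion_of_mem n hmem))).ne' (dist_self x)
  have hU : #(⋃ n, N n) ≤ max #E ℵ₀ := by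
    have h := mk_iUnion_le_lift N
    simp only [mk_nat, lift_aleph0, lift_uzero] at h
    refine h.trans ((mul_le_mul' le_rfl (ciSup_le' hcard)).trans ?_)
    rw [mul_comm]
    exact (mul_le_max _ _).trans (by simp)
  exact hS.not_ge ((mk_le_mk_of_subset hdense).trans
    ((mk_closure_le _).trans (power_le_power_right hU)))

/-- `S` is the projection of a closed subset of `Z × ℕ^ℕ`. -/
def IsClosedProjection {Z : Type*} [TopologicalSpace Z] (S : Set Z) : Prop :=
  ∃ F : Set (Z × (ℕ → ℕ)), IsClosed F ∧ Prod.fst '' F = S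

namespace IsClosedProjection

variable {Z : Type*} [TopologicalSpace Z]

lemma of_isClosed {S : Set Z} (hS : IsClosed S) : IsClosedProjection S :=
  ⟨S ×ˢ Set.univ, hS.prod isClosed_univ, fst_image_prod _ univ_nonempty⟩

lemma iUnion {S : ℕ → Set Z} (hS : ∀ n, IsClosedProjection (S n)) :
    IsClosedProjection (⋃ n, S n) := by
  choose F hF hFS using hS
  refine ⟨{p | (p.1, fun k => p.2 (k + 1)) ∈ F (p.2 0)}, ?_, ?_⟩
  · have : {p : Z × (ℕ → ℕ) | (p.1, fun k => p.2 (k + 1)) ∈ F (p.2 0)} =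
        ⋂ n, ({p | p.2 0 ≠ n} ∪ {p | (p.1, fun k => p.2 (k + 1)) ∈ F n}) := by
      ext p
      simp only [mem_ofPred_eq, mem_iInter, mem_union]
      exact ⟨fun h n => or_iff_not_imp_left.2 fun hn => not_not.1 hn ▸ h,
        fun h => (h (p.2 0)).resolve_left fun h => h rfl⟩
    rw [this]
    refine isClosed_iInter fun n => IsClosed.union ?_ ?_
    · exact (isClosed_discrete {n}ᶜ).preimage (f := fun p : Z × (ℕ → ℕ) => p.2 0) (by fun_prop)
    · exact (hF n).preimage (f := fun p : Z × (ℕ → ℕ) => (p.1, fun k => p.2 (k + 1)))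
        (by fun_prop)
  · ext z
    simp only [← hFS, mem_iUnion, mem_image, Prod.exists, exists_and_right, exists_eq_right,
      mem_ofPred_eq]
    constructor
    · rintro ⟨a, ha⟩
      exact ⟨_, _, ha⟩
    · rintro ⟨n, a, ha⟩
      exact ⟨fun k => Nat.casesOn k n a, ha⟩

lemma iInter {S : ℕ → Set Z} (hS : ∀ n, IsClosedProjection (S n)) :
    IsClosedProjection (⋂ n, S n) := by
  choose F hF hFS using hS
  refine ⟨⋂ n, {p | (p.1, fun k => p.2 (Nat.pair n k)) ∈ F n}, isClosed_iInter fun n => ?_, ?_⟩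
  · exact (hF n).preimage (f := fun p : Z × (ℕ → ℕ) => (p.1, fun k => p.2 (Nat.pair n k)))
      (by fun_prop)
  · ext z
    simp only [← hFS, mem_iInter, mem_image, Prod.exists, exists_and_right, exists_eq_right,
      mem_ofPred_eq]
    constructor
    · rintro ⟨a, ha⟩ n
      exact ⟨_, ha n⟩
    · intro h
      choose a ha using h
      exact ⟨fun k => a k.unpair.1 k.unpair.2, fun n => by simpa using ha n⟩

end IsClosedProjection

/-- Every Borel subset of a metrizable space `Z` is the projection of a closed subset of
`Z × ℕ^ℕ`. -/
lemma isClosedProjection_of_borel {Z : Type*} [PseudoMetricSpace Z] {B : Set Z}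
    (hB : @MeasurableSet Z (borel Z) B) : IsClosedProjection B := by
  borelize Z
  suffices IsClosedProjection B ∧ IsClosedProjection Bᶜ from this.1
  induction B, hB using MeasurableSet.induction_on_open with
  | isOpen U hU =>
    obtain ⟨F, hF, -, rfl, -⟩ := hU.exists_iUnion_isClosed
    exact ⟨.iUnion fun n => .of_isClosed (hF n), .of_isClosed hU.isClosed_compl⟩
  | compl t ht h => exact ⟨h.2, by simpa using h.1⟩
  | iUnion f _ _ h =>
    refine ⟨.iUnion fun n => (h n).1, ?_⟩
    rw [compl_iUnion]
    exact .iInter fun n => (h n).2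

/-- A metric space with an infinite dense subset of size at most `c` has a basis of size at most
`c`. -/
lemma exists_isTopologicalBasis_mk_le {X : Type u} [PseudoMetricSpace X] {D : Set X} (hD : Dense D)
    {c : Cardinal.{u}} (hc : ℵ₀ ≤ c) (hDc : #D ≤ c) :
    ∃ b : Set (Set X), IsTopologicalBasis b ∧ #b ≤ c := by
  refine ⟨range fun p : D × ℕ => ball (p.1 : X) (1 / ((p.2 : ℝ) + 1)), ?_, ?_⟩
  · refine isTopologicalBasis_of_isOpen_of_nhds ?_ fun x U hx hU => ?_
    · rintro _ ⟨p, rfl⟩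
      exact isOpen_ball
    · obtain ⟨ε, hε, hεU⟩ := Metric.isOpen_iff.1 hU x hx
      obtain ⟨n, hn⟩ := exists_nat_one_div_lt (half_pos hε)
      obtain ⟨d, hd, hxd⟩ := hD.exists_dist_lt x (Nat.one_div_pos_of_nat (α := ℝ) (n := n))
      refine ⟨_, ⟨(⟨d, hd⟩, n), rfl⟩, hxd, fun y hy => hεU ?_⟩
      have := dist_triangle_right y x d
      rw [mem_ball] at hy ⊢
      dsimp only at hy
      linarith
  · refine mk_range_le.trans ?_
    rw [mk_prod, lift_uzero, mk_nat, lift_aleph0]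
    exact (mul_le_mul' hDc hc).trans (mul_eq_self hc).le

/-- An absolute Borel space with a basis of infinite size at most `c` is the continuous image of a
completely metrizable space with a basis of size at most `c`. -/
lemma IsAbsoluteBorel.exists_continuous_surjective {X : Type u} [TopologicalSpace X]
    (hB : IsAbsoluteBorel X) {c : Cardinal.{u}} (hc : ℵ₀ ≤ c) {b : Set (Set X)}
    (hb : IsTopologicalBasis b) (hbc : #b ≤ c) :
    ∃ (Y : Type u) (_ : TopologicalSpace Y) (g : Y → X) (b' : Set (Set Y)),
      IsCompletelyMetrizableSpace Y ∧ Continuous g ∧ Function.Surjective g ∧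
      IsTopologicalBasis b' ∧ #b' ≤ c := by
  obtain ⟨Z, m, hZ, B, hB, ⟨e⟩⟩ := hB
  obtain ⟨F, hF, rfl⟩ := isClosedProjection_of_borel hB
  let q : F → Prod.fst '' F := fun p => ⟨p.1.1, mem_image_of_mem _ p.2⟩
  have hq : Continuous q := by fun_prop
  have hind : IsInducing fun p : F => (e.symm (q p), p.1.2) := by
    refine IsInducing.of_comp (g := fun r : X × (ℕ → ℕ) => ((e r.1 : Z), r.2)) (by fun_prop)
      (by fun_prop) ?_
    have hval : (fun r : X × (ℕ → ℕ) => ((e r.1 : Z), r.2)) ∘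
        (fun p : F => (e.symm (q p), p.1.2)) = Subtype.val := by
      ext p <;> simp [q]
    rw [hval]
    exact IsInducing.subtypeVal
  refine ⟨F, inferInstance, e.symm ∘ q, _, hF.isCompletelyMetrizableSpace,
    e.symm.continuous.comp hq, e.symm.surjective.comp ?_,
    (hb.prod (isBasis_countableBasis (ℕ → ℕ))).isInducing hind, ?_⟩
  · rintro ⟨_, p, hp, rfl⟩
    exact ⟨⟨p, hp⟩, rfl⟩
  · refine mk_image_le.trans ?_
    rw [← image_uncurry_prod]
    refine mk_le_of_surjective (f := fun r : b × countableBasis (ℕ → ℕ) =>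
      (⟨_, mem_image_of_mem _ (mk_mem_prod r.1.2 r.2.2)⟩ :
        (Function.uncurry fun (s : Set X) (t : Set (ℕ → ℕ)) => s ×ˢ t) ''
          b ×ˢ countableBasis (ℕ → ℕ))) ?_ |>.trans ?_
    · rintro ⟨_, ⟨s, t⟩, ⟨hs, ht⟩, rfl⟩
      exact ⟨(⟨s, hs⟩, ⟨t, ht⟩), rfl⟩
    · rw [mk_prod, lift_uzero]
      refine (mul_le_mul' hbc ?_).trans (mul_eq_self hc).le
      exact (lift_le_aleph0.2 (countable_countableBasis _).le_aleph0).trans hc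

/-- The part of a space on which a map is locally large. -/
lemma exists_isClosed_forall_lt_mk_image {X Y : Type u} [TopologicalSpace Y] (g : Y → X)
    (hg : Function.Surjective g) {c : Cardinal.{u}} (hc : ℵ₀ ≤ c) {b : Set (Set Y)}
    (hb : IsTopologicalBasis b) (hbc : #b ≤ c) (hX : c < #X) :
    ∃ F : Set Y, IsClosed F ∧ F.Nonempty ∧
      ∀ V, IsOpen V → (V ∩ F).Nonempty → c < #(g '' (V ∩ F)) := by
  let S := {s ∈ b | #(g '' s) ≤ c}
  have hS : #(g '' ⋃₀ S) ≤ c := by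
    rw [sUnion_eq_biUnion, image_iUnion₂]
    refine (mk_biUnion_le _ _).trans ?_
    refine (mul_le_mul' ((mk_le_mk_of_subset (sep_subset _ _)).trans hbc)
      (ciSup_le' fun s => s.2.2)).trans (mul_eq_self hc).le
  refine ⟨(⋃₀ S)ᶜ, (isOpen_sUnion fun s hs => hb.isOpen hs.1).isClosed_compl, ?_, ?_⟩
  · rw [nonempty_compl]
    intro h
    rw [h, image_univ, hg.range_eq, mk_univ] at hS
    exact hS.not_gt hX
  · rintro V hV ⟨y, hyV, hy⟩
    obtain ⟨s, hs, hys, hsV⟩ := hb.exists_subset_of_mem_open hyV hV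
    by_contra! h
    refine hy ⟨s, ⟨hs, ?_⟩, hys⟩
    have : g '' s ⊆ g '' (V ∩ (⋃₀ S)ᶜ) ∪ g '' ⋃₀ S := by
      rw [← image_union]
      refine image_mono fun x hx => ?_
      by_cases hxS : x ∈ ⋃₀ S
      · exact Or.inr hxS
      · exact Or.inl ⟨hsV hx, hxS⟩
    exact (mk_le_mk_of_subset this).trans ((mk_union_le _ _).trans
      ((add_le_add h hS).trans (add_eq_self hc).le))

/-- If `m` is infinite, `m < m ^ ℵ₀` and `n ^ ℵ₀ < m` for all `n < m`, then `m ^ ℵ₀` is at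
most the size of a countable product of sets smaller than `m`. -/
lemma exists_pi_of_lt_power_aleph0 {m : Cardinal.{u}} (hm : ℵ₀ ≤ m) (hlt : m < m ^ ℵ₀)
    (hpow : ∀ n < m, n ^ ℵ₀ < m) :
    ∃ D : ℕ → Type u, (∀ n, #(D n) < m) ∧ m ^ ℵ₀ ≤ #(∀ n, D n) := by
  let α := m.ord.ToType
  have hα : #α = m := mk_ord_toType m
  have hIio : ∀ a : α, #(Iio a) < m := fun a => by simpa [α] using mk_Iio_lt a
  obtain ⟨f, hf⟩ : ∃ f : ℕ → α, ∀ a, ∃ n, a < f n := by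
    by_contra! h
    choose a ha using h
    have hcover : (⋃ a : α, {f : ℕ → α | ∀ n, f n ≤ a}) = Set.univ :=
      eq_univ_of_forall fun f => mem_iUnion.2 ⟨a f, ha f⟩
    have hle : #(ℕ → α) ≤ m := by
      rw [← mk_univ, ← hcover]
      refine (mk_iUnion_le _).trans ?_
      rw [hα]
      refine (mul_le_mul' le_rfl (ciSup_le' fun a => ?_)).trans (mul_eq_self hm).le
      have hIic : #(Iic a) < m := by
        rw [← Iio_insert]
        exact mk_insert_le.trans_lt (add_lt_of_lt hm (hIio a) (one_lt_aleph0.trans_le hm))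
      have : #{f : ℕ → α | ∀ n, f n ≤ a} ≤ #(ℕ → Iic a) :=
        mk_le_of_injective (f := fun f n => (⟨f.1 n, f.2 n⟩ : Iic a)) fun f f' h =>
          Subtype.ext (funext fun n => congrArg Subtype.val (congrFun h n))
      refine this.trans ?_
      simpa using (hpow _ hIic).le
    have : #(ℕ → α) = m ^ ℵ₀ := by simp [α]
    exact (this ▸ hle).not_gt hlt
  refine ⟨fun k => Option (Iio (f k.unpair.2)), fun k => ?_, ?_⟩
  · rw [mk_option]
    exact add_lt_of_lt hm (hIio _) (one_lt_aleph0.trans_le hm)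
  · have : m ^ ℵ₀ = #(ℕ → α) := by simp [α]
    rw [this]
    refine mk_le_of_injective (f := fun x k => if h : x k.unpair.1 < f k.unpair.2 then
      some ⟨x k.unpair.1, h⟩ else none) fun x y hxy => funext fun i => ?_
    obtain ⟨n, hn⟩ := hf (x i)
    have h := congrFun hxy (Nat.pair i n)
    simp only [Nat.unpair_pair] at h
    grind

/-- The image of the Cantor space under a continuous injection into a Hausdorff space is a Cantor
space. -/
lemma nonempty_range_homeomorph {X : Type*} [TopologicalSpace X] [T2Space X] {h : CantorSpace → X}
    (hc : Continuous h) (hi : Function.Injective h) : Nonempty (range h ≃ₜ CantorSpace) :=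
  ⟨(hc.isClosedEmbedding hi).isEmbedding.toHomeomorph.symm⟩

/-- The members of a packing of Cantor spaces are nonempty. -/
lemma IsPacking.nonempty {X : Type*} [TopologicalSpace X] {Q : Set (Set X)}
    (hQ : IsPacking CantorSpace Q) {K : Set X} (hK : K ∈ Q) : K.Nonempty := by
  obtain ⟨e⟩ := hQ.1 K hK
  exact ⟨_, (e.symm fun _ => false).2⟩

lemma IsPacking.mk_le {X : Type u} [TopologicalSpace X] {Q : Set (Set X)}
    (hQ : IsPacking CantorSpace Q) : #Q ≤ #X := by
  choose x hx using fun K : Q => hQ.nonempty K.2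
  refine mk_le_of_injective (f := x) fun K L hKL => Subtype.ext ?_
  exact hQ.2.elim_set K.2 L.2 (x K) (hx K) (hKL ▸ hx L)

/-- A large family of Cantor spaces with pairwise disjoint images. -/
lemma exists_isPacking_of_injective2 {X P : Type u} [TopologicalSpace X] [T2Space X]
    {h : P → CantorSpace → X} (hc : ∀ p, Continuous (h p)) (hi : Function.Injective2 h)
    (hP : #X ≤ #P) : ∃ Q : Set (Set X), IsPacking CantorSpace Q ∧ #Q = #X := by
  have hpack : IsPacking CantorSpace (range fun p => range (h p)) := by
    constructor
    · rintro _ ⟨p, rfl⟩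
      exact nonempty_range_homeomorph (hc p) fun a b hab => (hi hab).2
    · rintro _ ⟨p, rfl⟩ _ ⟨p', rfl⟩ hne
      refine Set.disjoint_left.2 ?_
      rintro _ ⟨a, rfl⟩ ⟨b, hab⟩
      exact hne (by rw [(hi hab).1])
  refine ⟨_, hpack, hpack.mk_le.antisymm ?_⟩
  rw [mk_range_eq]
  · exact hP
  · intro p p' hpp
    have : h p (fun _ => false) ∈ range (h p') := by
      rw [← show range (h p) = range (h p') from hpp]
      exact mem_range_self _
    obtain ⟨b, hb⟩ := this
    exact (hi hb).1.symm

lemma exists_maximal_isPacking (X : Type*) [TopologicalSpace X] :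
    ∃ Q : Set (Set X), Maximal (IsPacking CantorSpace) Q := by
  refine zorn_subset {Q : Set (Set X) | IsPacking CantorSpace Q} fun c hc hchain =>
    ⟨⋃₀ c, ⟨?_, ?_⟩, fun Q hQ => subset_sUnion_of_mem hQ⟩
  · rintro K ⟨Q, hQ, hK⟩
    exact (hc hQ).1 K hK
  · exact (pairwiseDisjoint_sUnion hchain.directedOn).2 fun Q hQ => (hc hQ).2

/-- Every nonempty open subset of the Cantor space contains a copy of the Cantor space. -/
lemma exists_continuous_injective_mem_of_isOpen {V : Set CantorSpace} (hV : IsOpen V)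
    (hne : V.Nonempty) :
    ∃ c : CantorSpace → CantorSpace, Continuous c ∧ Function.Injective c ∧ ∀ b, c b ∈ V := by
  obtain ⟨a, ha⟩ := hne
  obtain ⟨_, ⟨x, n, rfl⟩, hax, hxV⟩ :=
    (PiNat.isTopologicalBasis_cylinders fun _ : ℕ => Bool).exists_subset_of_mem_open ha hV
  refine ⟨fun b i => if i < n then x i else b (i - n), ?_, fun b b' h => ?_, fun b => hxV ?_⟩
  · refine continuous_pi fun i => ?_
    split_ifs <;> fun_prop
  · funext i
    simpa using congrFun h (i + n)
  · rw [PiNat.mem_cylinder_iff]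
    intro i hi
    simp [hi]

/-- A maximal packing of Cantor spaces into a space covered by Cantor spaces is dense. -/
lemma dense_sUnion_of_maximal_isPacking {X : Type*} [TopologicalSpace X] [T2Space X]
    (hcov : Coverable X CantorSpace) {Q : Set (Set X)}
    (hQ : Maximal (IsPacking CantorSpace) Q) : Dense (⋃₀ Q) := by
  intro x
  by_contra hx
  obtain ⟨C, hC, hCu⟩ := hcov
  obtain ⟨K, hK, hxK⟩ : x ∈ ⋃₀ C := hCu ▸ mem_univ x
  obtain ⟨e⟩ := hC K hK
  have hφ : Continuous fun b => (e.symm b : X) := by fun_prop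
  obtain ⟨c, hc, hci, hcV⟩ := exists_continuous_injective_mem_of_isOpen
    ((isClosed_closure (s := ⋃₀ Q)).isOpen_compl.preimage hφ) ⟨e ⟨x, hxK⟩, by simpa using hx⟩
  set K' := range fun b => (e.symm (c b) : X)
  have hK'Q : ∀ L ∈ Q, Disjoint K' L := by
    intro L hL
    rw [Set.disjoint_left]
    rintro _ ⟨b, rfl⟩ hb
    exact hcV b (subset_closure ⟨L, hL, hb⟩)
  have hpack : IsPacking CantorSpace (insert K' Q) := by
    refine ⟨?_, hQ.1.2.insert fun L hL _ => hK'Q L hL⟩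
    rintro L (rfl | hL)
    · exact nonempty_range_homeomorph (hφ.comp hc)
        ((Subtype.val_injective.comp e.symm.injective).comp hci)
    · exact hQ.1.1 L hL
  have hmem : K' ∈ Q := hQ.2 hpack (subset_insert _ _) (mem_insert _ _)
  exact (range_nonempty _).ne_empty (disjoint_self.1 (hK'Q K' hmem))

lemma IsPacking.mk_sUnion_le {X : Type u} [TopologicalSpace X] {Q : Set (Set X)}
    (hQ : IsPacking CantorSpace Q) : #(⋃₀ Q) ≤ max #Q 𝔠 := by
  refine (Cardinal.mk_sUnion_le Q).trans ((mul_le_mul' le_rfl (ciSup_le' fun K => ?_)).trans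
    ((mul_le_max _ 𝔠).trans (by simp [aleph0_le_continuum])))
  obtain ⟨e⟩ := hQ.1 K K.2
  have h := mk_congr_lift e.toEquiv
  simp at h
  exact h.le

lemma exists_isPacking_of_mk_le_continuum {X : Type u} [TopologicalSpace X] [T2Space X]
    (hcov : Coverable X CantorSpace) (hX : #X ≤ 𝔠) :
    ∃ Q : Set (Set X), IsPacking CantorSpace Q ∧ #Q = #X := by
  rcases isEmpty_or_nonempty X with hE | ⟨⟨x⟩⟩
  · exact ⟨∅, ⟨by simp, by simp⟩, by simp⟩
  obtain ⟨C, hC, hCu⟩ := hcov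
  obtain ⟨K, hK, -⟩ : x ∈ ⋃₀ C := hCu ▸ mem_univ x
  obtain ⟨e⟩ := hC K hK
  let pair : CantorSpace → CantorSpace → ℕ → CantorSpace := fun a b n => if n = 0 then a else b
  refine exists_isPacking_of_injective2 (P := ULift.{u} CantorSpace) (h := fun p b =>
    (e.symm (cantorSpaceHomeomorphNatToCantorSpace.symm (pair p.down b)) : X)) (fun p => ?_) ?_
    (by simpa using hX)
  · have : Continuous (pair p.down) := by
      refine continuous_pi fun n => ?_
      by_cases hn : n = 0
      · simpa [pair, hn] using continuous_const
      · simpa [pair, hn] using continuous_id'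
    fun_prop
  · intro p p' b b' h
    have h' : pair p.down b = pair p'.down b' :=
      cantorSpaceHomeomorphNatToCantorSpace.symm.injective
        (e.symm.injective (Subtype.val_injective h))
    exact ⟨ULift.ext _ _ (by simpa [pair] using congrFun h' 0),
      by simpa [pair] using congrFun h' 1⟩

/-- A metrizable absolute Borel space whose cardinality exceeds both the continuum and the size of
some dense subset admits a full-sized packing. -/
lemma exists_isPacking_of_dense {X : Type u} [MetricSpace X] (hB : IsAbsoluteBorel X)
    {D : Set X} (hD : Dense D) {l : Cardinal.{u}} (hl : 𝔠 ≤ l) (hDl : #D ≤ l) (hlX : l < #X) :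
    ∃ Q : Set (Set X), IsPacking CantorSpace Q ∧ #Q = #X := by
  have hl0 : ℵ₀ ≤ l := aleph0_le_continuum.trans hl
  have hXl : #X ≤ l ^ ℵ₀ := by
    have h := mk_closure_le D
    rw [hD.closure_eq, mk_univ] at h
    exact h.trans (power_le_power_right hDl)
  obtain ⟨m, hm, hmin⟩ := WellFounded.has_min (wellFounded_lt (α := Cardinal.{u}))
    {m | #X ≤ m ^ ℵ₀} ⟨l, hXl⟩
  have hml : m ≤ l := not_lt.1 (hmin l hXl)
  have hpow : ∀ n < m, n ^ ℵ₀ < m := by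
    intro n hn
    by_contra! h
    refine hmin n ?_ hn
    refine (show #X ≤ m ^ ℵ₀ from hm).trans ((power_le_power_right h).trans ?_)
    rw [← power_mul, aleph0_mul_aleph0]
  have hm0 : ℵ₀ < m := by
    by_contra! h
    have : m ^ ℵ₀ ≤ 𝔠 := (power_le_power_right h).trans (by simp)
    exact ((show #X ≤ m ^ ℵ₀ from hm).trans (this.trans hl)).not_gt hlX
  obtain ⟨E, hE, hEm⟩ :=
    exists_pi_of_lt_power_aleph0 hm0.le (hml.trans_lt (hlX.trans_le hm)) hpow
  obtain ⟨b, hb, hbl⟩ := exists_isTopologicalBasis_mk_le hD hl0 hDl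
  obtain ⟨Y, _, g, b', _, hg, hgs, hb', hbl'⟩ := hB.exists_continuous_surjective hl0 hb hbl
  obtain ⟨F, hF, hFne, hFl⟩ := exists_isClosed_forall_lt_mk_image g hgs hl0 hb' hbl' hlX
  have := hF.isCompletelyMetrizableSpace
  let := upgradeIsCompletelyMetrizable F
  have := hFne.to_subtype
  let : ∀ n, TopologicalSpace (E n) := fun _ => ⊥
  have : ∀ n, DiscreteTopology (E n) := fun _ => ⟨rfl⟩
  obtain ⟨h, hc, hi⟩ := exists_continuous_injective_pi (g := fun y : F => g y) (by fun_prop)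
    (E := fun n => E n × Bool) fun U hU hUne n => by
      obtain ⟨V, hV, rfl⟩ := isOpen_induced_iff.1 hU
      have hVF : (V ∩ F).Nonempty := by
        obtain ⟨y, hy⟩ := hUne
        exact ⟨y, hy, y.2⟩
      obtain ⟨ε, hε, φ, hφ, hsep⟩ := exists_separated_family (g '' (V ∩ F)) (E n × Bool) (by
        refine (hpow _ (max_lt ?_ hm0)).trans_le (hml.trans (hFl V hV hVF).le)
        simpa using mul_lt_of_lt hm0.le (hE n) ((natCast_lt_aleph0 (n := 2)).trans hm0))
      choose y hy hyφ using hφ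
      exact ⟨ε, hε, fun e => ⟨y e, (hy e).2⟩, fun e => (hy e).1,
        fun e e' hne => by simpa [hyφ] using hsep e e' hne⟩
  refine exists_isPacking_of_injective2 (P := ∀ n, E n) (h := fun d a => h fun n => (d n, a n))
    (fun d => hc.comp (by fun_prop)) ?_ (hm.trans hEm)
  intro d d' a a' haa
  have := hi haa
  exact ⟨funext fun n => congrArg Prod.fst (congrFun this n),
    funext fun n => congrArg Prod.snd (congrFun this n)⟩

lemma IsAbsoluteBorel.metrizableSpace {X : Type u} [TopologicalSpace X] (hB : IsAbsoluteBorel X) :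
    MetrizableSpace X := by
  obtain ⟨Z, m, -, B, -, ⟨e⟩⟩ := hB
  exact e.isEmbedding.metrizableSpace

theorem stmt_13 {X : Type u} [TopologicalSpace X] (hB : IsAbsoluteBorel X)
    (hcov : Coverable X CantorSpace) :
    ∃ Q : Set (Set X), IsPacking CantorSpace Q ∧ Cardinal.mk Q = Cardinal.mk X := by
  have := hB.metrizableSpace
  let := metrizableSpaceMetric X
  rcases le_or_gt #X 𝔠 with hX | hX
  · exact exists_isPacking_of_mk_le_continuum hcov hX
  obtain ⟨Q, hQ⟩ := exists_maximal_isPacking X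
  rcases le_or_gt #X #Q with hXQ | hXQ
  · exact ⟨Q, hQ.1, hQ.1.mk_le.antisymm hXQ⟩
  · exact exists_isPacking_of_dense hB (dense_sUnion_of_maximal_isPacking hcov hQ)
      (le_max_right _ _) hQ.1.mk_sUnion_le (max_lt hXQ hX)
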